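/- Let n ≥ 2, k ≥ 3, 0 < ε ≤ 1, let a ≠ b be alternatives, and let f : S_k^n → [k] be an SCF with D(f, NONMANIP-bar) ≥ ε. Then either P(σ_{−1} ∈ D_1(a,b)) ≤ ε^4 / (4 n^5 k^12 · k!) (where σ_{−1} is uniform on S_k^{n−1}), or P(σ ∈ M(f)) ≥ ε^5 / (4 n^7 k^12 (k!)^4). -/

import Mathlib

open Finset

/-- `a` is ranked above `b` in the ranking `τ` (a ranking maps positions to
alternatives; earlier positions are better). -/
def Above {k : ℕ} (τ : Equiv.Perm (Fin k)) (a b : Fin k) : Prop :=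
  τ.symm a < τ.symm b

/-- Uniform probability of an event over a finite type. -/
noncomputable def prob {Ω : Type*} [Fintype Ω] (p : Ω → Prop) : ℝ := by
  classical exact ((Finset.univ.filter p).card : ℝ) / (Fintype.card Ω : ℝ)

/-- Number of elements satisfying an event, as a real number. -/
noncomputable def count {Ω : Type*} [Fintype Ω] (p : Ω → Prop) : ℝ := by
  classical exact ((Finset.univ.filter p).card : ℝ)

/-- A ranking profile for `n` voters and `k` alternatives. -/
abbrev Profile (n k : ℕ) := Fin n → Equiv.Perm (Fin k)

/-- `(σ, σ')` is a manipulation pair for `f` at coordinate `i`: they differ exactly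
in coordinate `i` and voter `i` truly prefers `f σ'` to `f σ`. -/
def IsManipPairAt {n k : ℕ} (f : Profile n k → Fin k) (σ σ' : Profile n k) (i : Fin n) : Prop :=
  σ i ≠ σ' i ∧ (∀ j, j ≠ i → σ j = σ' j) ∧ Above (σ i) (f σ') (f σ)

/-- `σ` is a manipulation point of `f`, i.e. `σ ∈ M(f)`. -/
def IsManipPoint {n k : ℕ} (f : Profile n k → Fin k) (σ : Profile n k) : Prop :=
  ∃ σ' i, IsManipPairAt f σ σ' i

/-- `τ` and `τ'` agree outside a block of at most `r` consecutive positions. -/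
def AgreeOutsideBlock {k : ℕ} (r : ℕ) (τ τ' : Equiv.Perm (Fin k)) : Prop :=
  ∃ l : ℕ, ∀ p : Fin k, ((p : ℕ) < l ∨ l + r ≤ (p : ℕ)) → τ p = τ' p

/-- `σ` is an `r`-manipulation point of `f`, i.e. `σ ∈ M_r(f)`. -/
def IsManipPointR {n k : ℕ} (r : ℕ) (f : Profile n k → Fin k) (σ : Profile n k) : Prop :=
  ∃ σ' i, IsManipPairAt f σ σ' i ∧ AgreeOutsideBlock r (σ i) (σ' i)

/-- `f` always elects the top alternative of `H` according to voter `i`. -/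
def IsTopOn {n k : ℕ} (f : Profile n k → Fin k) (i : Fin n) (H : Finset (Fin k)) : Prop :=
  ∀ σ, f σ ∈ H ∧ ∀ b ∈ H, b ≠ f σ → Above (σ i) (f σ) b

/-- `f` takes exactly two values. -/
def TakesExactlyTwoValues {n k : ℕ} (f : Profile n k → Fin k) : Prop :=
  ∃ a b : Fin k, a ≠ b ∧ (∀ σ, f σ = a ∨ f σ = b) ∧ (∃ σ, f σ = a) ∧ (∃ σ, f σ = b)

/-- `f` is monotone: whenever `σ, σ'` differ in exactly one coordinate `i` and
`f σ ≠ f σ'`, voter `i` ranks `f σ'` above `f σ` in `σ' i`. -/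
def IsMonotone {n k : ℕ} (f : Profile n k → Fin k) : Prop :=
  ∀ (σ σ' : Profile n k) (i : Fin n),
    σ i ≠ σ' i → (∀ j, j ≠ i → σ j = σ' j) → f σ ≠ f σ' → Above (σ' i) (f σ') (f σ)

/-- The family `NONMANIP(n,k)` of nonmanipulable social choice functions. -/
def InNonManip {n k : ℕ} (f : Profile n k → Fin k) : Prop :=
  (∃ (i : Fin n) (H : Finset (Fin k)), H.Nonempty ∧ IsTopOn f i H) ∨
  (TakesExactlyTwoValues f ∧ IsMonotone f)

/-- The family `NONMANIP-bar`: functions depending on one coordinate only,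
or taking at most two values. -/
def InNonManipBar {n k : ℕ} (f : Profile n k → Fin k) : Prop :=
  (∃ i : Fin n, ∀ σ σ' : Profile n k, σ i = σ' i → f σ = f σ') ∨
  (∃ a b : Fin k, ∀ σ, f σ = a ∨ f σ = b)

/-- `σ` lies in the fiber `F(z^{a,b})`: `z i = true` iff voter `i` prefers `a` to `b`. -/
def InFiber {n k : ℕ} (a b : Fin k) (z : Fin n → Bool) (σ : Profile n k) : Prop :=
  ∀ i, Above (σ i) a b ↔ z i = true

/-- `σ` is on the boundary `B_i^{a,b}(f)`: `f σ = a` and some `σ'` differing from `σ`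
only in coordinate `i` has `f σ' = b`. -/
def OnBoundaryB {n k : ℕ} (f : Profile n k → Fin k) (i : Fin n) (a b : Fin k)
    (σ : Profile n k) : Prop :=
  f σ = a ∧ ∃ σ' : Profile n k, σ i ≠ σ' i ∧ (∀ j, j ≠ i → σ j = σ' j) ∧ f σ' = b

/-- `σ ∈ B_i(z^{a,b})`. -/
def InBFiber {n k : ℕ} (f : Profile n k → Fin k) (i : Fin n) (a b : Fin k)
    (z : Fin n → Bool) (σ : Profile n k) : Prop :=
  InFiber a b z σ ∧ OnBoundaryB f i a b σ

/-- The fiber `B_i(z^{a,b})` is large (for the parameter `ε`):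
`P(σ ∈ B_i(z^{a,b}) | σ ∈ F(z^{a,b})) ≥ 1 - ε^3/(4 n^3 k^9)`. -/
def IsLargeFiber {n k : ℕ} (f : Profile n k → Fin k) (ε : ℝ) (i : Fin n) (a b : Fin k)
    (z : Fin n → Bool) : Prop :=
  1 - ε ^ 3 / (4 * (n : ℝ) ^ 3 * (k : ℝ) ^ 9) ≤
    prob (fun σ : Profile n k => InBFiber f i a b z σ) /
      prob (fun σ : Profile n k => InFiber a b z σ)

/-- `σ ∈ Lg(B_i^{a,b})`, the union of the large fibers. -/
def InLg {n k : ℕ} (f : Profile n k → Fin k) (ε : ℝ) (i : Fin n) (a b : Fin k)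
    (σ : Profile n k) : Prop :=
  ∃ z, IsLargeFiber f ε i a b z ∧ InBFiber f i a b z σ

/-- `σ ∈ Sm(B_i^{a,b})`, the union of the small fibers. -/
def InSm {n k : ℕ} (f : Profile n k → Fin k) (ε : ℝ) (i : Fin n) (a b : Fin k)
    (σ : Profile n k) : Prop :=
  ∃ z, ¬ IsLargeFiber f ε i a b z ∧ InBFiber f i a b z σ

/-- Two profiles differ in exactly one coordinate. -/
def AdjOneCoord {n k : ℕ} (σ π : Profile n k) : Prop :=
  ∃ i, σ i ≠ π i ∧ ∀ j, j ≠ i → σ j = π j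

/-- `σ` belongs to the vertex boundary `∂(B_i(z^{a,b}))` of `B_i(z^{a,b})` inside the
fiber `F(z^{a,b})`. -/
def InFiberBdry {n k : ℕ} (f : Profile n k → Fin k) (i : Fin n) (a b : Fin k)
    (z : Fin n → Bool) (σ : Profile n k) : Prop :=
  InBFiber f i a b z σ ∧
    ∃ π, AdjOneCoord σ π ∧ InFiber a b z π ∧ ¬ InBFiber f i a b z π

/-- `σ₋ᵢ ∈ D_i(a,b)`: fixing all coordinates except `i` according to `σ`, the induced
one-voter SCF equals `top_H` for some `H ⊇ {a,b}` with `|H| ≥ 3`. -/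
def InD1 {n k : ℕ} (f : Profile n k → Fin k) (i : Fin n) (a b : Fin k)
    (σ : Profile n k) : Prop :=
  ∃ H : Finset (Fin k), a ∈ H ∧ b ∈ H ∧ 3 ≤ H.card ∧
    ∀ τ : Equiv.Perm (Fin k),
      f (Function.update σ i τ) ∈ H ∧
        ∀ c ∈ H, c ≠ f (Function.update σ i τ) → Above τ (f (Function.update σ i τ)) c


/-! ### Rankings -/

theorem above_irrefl' {k : ℕ} (τ : Equiv.Perm (Fin k)) (a : Fin k) : ¬ Above τ a a := by
  simp [Above]

theorem above_asymm' {k : ℕ} {τ : Equiv.Perm (Fin k)} {a b : Fin k} (h : Above τ a b) :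
    ¬ Above τ b a := by
  unfold Above at *; exact not_lt.mpr h.le

theorem above_total' {k : ℕ} {τ : Equiv.Perm (Fin k)} {a b : Fin k} (h : ¬ Above τ a b)
    (hne : a ≠ b) : Above τ b a := by
  unfold Above at *
  rcases lt_trichotomy (τ.symm a) (τ.symm b) with h1 | h1 | h1
  · exact absurd h1 h
  · exact absurd (τ.symm.injective h1) hne
  · exact h1

/-- There is a ranking with given first and second alternatives. -/
theorem exists_ranking {k : ℕ} (hk : 3 ≤ k) (p q : Fin k) (hpq : p ≠ q) :
    ∃ τ : Equiv.Perm (Fin k), (∀ z, z ≠ p → Above τ p z) ∧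
      (∀ z, z ≠ p → z ≠ q → Above τ q z) := by
  let z0 : Fin k := ⟨0, by omega⟩
  let z1 : Fin k := ⟨1, by omega⟩
  have h01 : z0 ≠ z1 := by simp [z0, z1]
  obtain ⟨ρ, hρ0, hρ1⟩ : ∃ ρ : Equiv.Perm (Fin k), ρ p = z0 ∧ ρ q = z1 := by
    refine ⟨(Equiv.swap p z0).trans (Equiv.swap (Equiv.swap p z0 q) z1), ?_, ?_⟩
    · have h1 : z0 ≠ Equiv.swap p z0 q := by
        intro h
        have : Equiv.swap p z0 p = Equiv.swap p z0 q := by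
          rw [Equiv.swap_apply_left]; exact h
        exact hpq ((Equiv.swap p z0).injective this)
      simp only [Equiv.trans_apply, Equiv.swap_apply_left]
      exact Equiv.swap_apply_of_ne_of_ne h1 h01
    · simp
  refine ⟨ρ.symm, ?_, ?_⟩
  · intro z hz
    have h : ρ z ≠ z0 := fun h => hz (ρ.injective (h.trans hρ0.symm))
    simp only [Above, Equiv.symm_symm, hρ0]
    have h' : (ρ z : ℕ) ≠ 0 := fun e => h (Fin.ext e)
    show 0 < (ρ z : ℕ)
    omega
  · intro z hz hz'
    have h : ρ z ≠ z0 := fun h => hz (ρ.injective (h.trans hρ0.symm))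
    have h2 : ρ z ≠ z1 := fun h => hz' (ρ.injective (h.trans hρ1.symm))
    simp only [Above, Equiv.symm_symm, hρ1]
    have h' : (ρ z : ℕ) ≠ 0 := fun e => h (Fin.ext e)
    have h2' : (ρ z : ℕ) ≠ 1 := fun e => h2 (Fin.ext e)
    show 1 < (ρ z : ℕ)
    omega

/-! ### A two-voter Gibbard-Satterthwaite argument -/

section TwoVoter

variable {k : ℕ}

/-- Voter 1 elects the top of the range. -/
theorem eq_top_of_first {F : Equiv.Perm (Fin k) → Equiv.Perm (Fin k) → Fin k}
    (h1 : ∀ x x' y, ¬ Above x (F x' y) (F x y))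
    {x x' y : Equiv.Perm (Fin k)} {p : Fin k} (hp : F x' y = p)
    (hx : ∀ z, z ≠ p → Above x p z) : F x y = p := by
  by_contra hne
  exact h1 x x' y (by rw [hp]; exact hx _ hne)

theorem eq_second {F : Equiv.Perm (Fin k) → Equiv.Perm (Fin k) → Fin k}
    (h1 : ∀ x x' y, ¬ Above x (F x' y) (F x y))
    {x x' y : Equiv.Perm (Fin k)} {p q : Fin k} (hp : ∀ u, F u y ≠ p) (hq : F x' y = q)
    (hx : ∀ z, z ≠ p → z ≠ q → Above x q z) : F x y = q := by
  by_contra hne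
  exact h1 x x' y (by rw [hq]; exact hx _ (hp x) hne)

theorem two_voter_A (hk : 3 ≤ k) (F : Equiv.Perm (Fin k) → Equiv.Perm (Fin k) → Fin k)
    (h1 : ∀ x x' y, ¬ Above x (F x' y) (F x y))
    (h2 : ∀ x y y', ¬ Above y (F x y') (F x y))
    (y0 y1 : Equiv.Perm (Fin k)) (c p q : Fin k) (hc1 : ∃ x, F x y1 = c)
    (hc0 : ∀ x, F x y0 ≠ c) (hp : ∃ x, F x y0 = p) (hq : ∃ x, F x y0 = q) (hpq : p ≠ q) :
    False := by
  wlog hab : Above y0 p q generalizing p q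
  · exact this q p hq hp hpq.symm (above_total' hab hpq)
  obtain ⟨xc, hxc⟩ := hc1
  obtain ⟨xp, hxp⟩ := hp
  obtain ⟨xq, hxq⟩ := hq
  have hpc : p ≠ c := fun h => hc0 xp (hxp.trans h)
  have hqc : q ≠ c := fun h => hc0 xq (hxq.trans h)
  obtain ⟨y2, hy2, hy2'⟩ := exists_ranking hk p c hpc
  obtain ⟨s, hs, hs'⟩ := exists_ranking hk c p hpc.symm
  obtain ⟨t, ht, ht'⟩ := exists_ranking hk c q hqc.symm
  obtain ⟨r, hr, hr'⟩ := exists_ranking hk q p hpq.symm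
  have e1 : F s y0 = p := eq_second h1 hc0 hxp hs'
  have e2 : F s y2 = p := by
    by_contra hne
    exact h2 s y2 y0 (by rw [e1]; exact hy2 _ hne)
  have hc2 : ∀ u, F u y2 ≠ c := by
    intro u hu
    exact h1 s u y2 (by rw [hu, e2]; exact hs _ hpc)
  have e3 : F t y1 = c := eq_top_of_first h1 hxc ht
  have e4 : F t y2 = p := by
    by_contra hne
    exact h2 t y2 y1 (by rw [e3]; exact hy2' _ hne (hc2 t))
  have hq2 : ∀ u, F u y2 ≠ q := by
    intro u hu
    exact h1 t u y2 (by rw [hu, e4]; exact ht' _ hpc hpq)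
  have e5 : F r y2 = p := eq_second h1 hq2 e2 hr'
  have e6 : F r y0 = q := eq_top_of_first h1 hxq hr
  exact h2 r y0 y2 (by rw [e5, e6]; exact hab)

theorem two_voter_B (hk : 3 ≤ k) (F : Equiv.Perm (Fin k) → Equiv.Perm (Fin k) → Fin k)
    (h1 : ∀ x x' y, ¬ Above x (F x' y) (F x y))
    (h2 : ∀ x y y', ¬ Above y (F x y') (F x y))
    (y0 y1 : Equiv.Perm (Fin k)) (w u v : Fin k) (hw : ∀ x, F x y1 = w)
    (hu : ∃ x, F x y0 = u) (hv : ∃ x, F x y0 = v) (huv : u ≠ v)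
    (huw : u ≠ w) (hvw : v ≠ w) : False := by
  wlog hab : Above y0 u v generalizing u v
  · exact this v u hv hu huv.symm hvw huw (above_total' hab huv)
  obtain ⟨xu, hxu⟩ := hu
  obtain ⟨xv, hxv⟩ := hv
  obtain ⟨y2, hy2, hy2'⟩ := exists_ranking hk u w huw
  obtain ⟨s, hs, hs'⟩ := exists_ranking hk u v huv
  obtain ⟨r, hr, hr'⟩ := exists_ranking hk v u huv.symm
  have e1 : F s y0 = u := eq_top_of_first h1 hxu hs
  have e2 : F s y2 = u := by
    by_contra hne
    exact h2 s y2 y0 (by rw [e1]; exact hy2 _ hne)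
  have e3 : F r y2 ≠ v := by
    intro h
    exact h2 r y2 y1 (by rw [hw, h]; exact hy2' _ huv.symm hvw)
  have hv2 : ∀ x, F x y2 ≠ v := fun x hx => e3 (eq_top_of_first h1 hx hr)
  have e5 : F r y2 = u := eq_second h1 hv2 e2 hr'
  have e6 : F r y0 = v := eq_top_of_first h1 hxv hr
  exact h2 r y0 y2 (by rw [e5, e6]; exact hab)

theorem two_voter (hk : 3 ≤ k) (F : Equiv.Perm (Fin k) → Equiv.Perm (Fin k) → Fin k)
    (h1 : ∀ x x' y, ¬ Above x (F x' y) (F x y))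
    (h2 : ∀ x y y', ¬ Above y (F x y') (F x y))
    (y0 y1 : Equiv.Perm (Fin k)) (H : Finset (Fin k)) (hH : 3 ≤ H.card)
    (hr : ∀ c ∈ H, ∃ x, F x y0 = c) (hne : ∃ x, F x y1 ≠ F x y0) : False := by
  obtain ⟨p, hp, q, hq, r, hr', hpq, hpr, hqr⟩ := Finset.two_lt_card.mp (show 2 < H.card by omega)
  by_cases hA : ∃ c, (∃ x, F x y1 = c) ∧ ∀ x, F x y0 ≠ c
  · obtain ⟨c, hc1, hc0⟩ := hA
    exact two_voter_A hk F h1 h2 y0 y1 c p q hc1 hc0 (hr p hp) (hr q hq) hpq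
  push Not at hA
  by_cases hB : ∃ c, (∃ x, F x y0 = c) ∧ ∀ x, F x y1 ≠ c
  · obtain ⟨c, hc0, hc1⟩ := hB
    by_cases hw : ∀ x, F x y1 = F 1 y1
    · have key : ∃ u ∈ H, ∃ v ∈ H, u ≠ v ∧ u ≠ F 1 y1 ∧ v ≠ F 1 y1 := by
        by_cases e1 : p = F 1 y1
        · exact ⟨q, hq, r, hr', hqr, fun h => hpq (e1.trans h.symm),
            fun h => hpr (e1.trans h.symm)⟩
        · by_cases e2 : q = F 1 y1
          · exact ⟨p, hp, r, hr', hpr, e1, fun h => hqr (e2.trans h.symm)⟩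
          · exact ⟨p, hp, q, hq, hpq, e1, e2⟩
      obtain ⟨u, hu, v, hv, huv, huw, hvw⟩ := key
      exact two_voter_B hk F h1 h2 y0 y1 _ u v hw (hr u hu) (hr v hv) huv huw hvw
    · push Not at hw
      obtain ⟨x, hx⟩ := hw
      exact two_voter_A hk F h1 h2 y1 y0 c _ _ hc0 hc1 ⟨x, rfl⟩ ⟨1, rfl⟩ hx
  push Not at hB
  obtain ⟨x, hx⟩ := hne
  obtain ⟨x', hx'⟩ := hA (F x y1) ⟨x, rfl⟩
  obtain ⟨x'', hx''⟩ := hB (F x y0) ⟨x, rfl⟩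
  have g1 := h1 x x' y0
  have g2 := h1 x x'' y1
  rw [hx'] at g1
  rw [hx''] at g2
  exact g1 (above_total' g2 hx.symm)

end TwoVoter

/-! ### Boundary points produce manipulation points -/

/-- `σ` is in `D_1(a,b)` and changing coordinate `j` can change the induced one-voter SCF. -/
def BdryAt {n k : ℕ} (f : Profile n k → Fin k) (i0 : Fin n) (a b : Fin k) (j : Fin n)
    (σ : Profile n k) : Prop :=
  InD1 f i0 a b σ ∧ ∃ τ ρ : Equiv.Perm (Fin k),
    f (Function.update (Function.update σ j ρ) i0 τ) ≠ f (Function.update σ i0 τ)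

theorem exists_manip_of_bdry {n k : ℕ} (hk : 3 ≤ k) (f : Profile n k → Fin k) (i0 : Fin n)
    (a b : Fin k) (j : Fin n) (σ : Profile n k) (h : BdryAt f i0 a b j σ) :
    ∃ x y : Equiv.Perm (Fin k),
      IsManipPoint f (Function.update (Function.update σ j y) i0 x) := by
  obtain ⟨⟨H, -, -, hH, hT⟩, τ, ρ, hne⟩ := h
  by_contra hno
  push Not at hno
  have hj : j ≠ i0 := by
    rintro rfl
    simp at hne
  refine two_voter hk (fun x y => f (Function.update (Function.update σ j y) i0 x)) ?_ ?_
    (σ j) ρ H hH ?_ ⟨τ, by simpa using hne⟩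
  · intro x x' y hA
    refine hno x y ⟨Function.update (Function.update σ j y) i0 x', i0, ?_, ?_, ?_⟩
    · simp only [Function.update_self]
      rintro rfl
      exact above_irrefl' _ _ hA
    · intro l hl
      simp [Function.update_of_ne hl]
    · simpa using hA
  · intro x y y' hA
    refine hno x y ⟨Function.update (Function.update σ j y') i0 x, j, ?_, ?_, ?_⟩
    · simp only [Function.update_of_ne hj, Function.update_self]
      rintro rfl
      exact above_irrefl' _ _ hA
    · intro l hl
      by_cases hl0 : l = i0
      · subst hl0; simp
      · simp [Function.update_of_ne hl, Function.update_of_ne hl0]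
    · simpa [Function.update_of_ne hj] using hA
  · intro c hc
    have hk' : ∃ q : Fin k, c ≠ q := by
      by_contra hcon
      push Not at hcon
      have h0 := hcon ⟨0, by omega⟩
      have h1 := hcon ⟨1, by omega⟩
      have := h0.symm.trans h1
      simp at this
    obtain ⟨q, hq⟩ := hk'
    obtain ⟨x, hx, -⟩ := exists_ranking hk c q hq
    refine ⟨x, ?_⟩
    simp only [Function.update_eq_self]
    by_contra hcon
    exact above_asymm' ((hT x).2 c hc (Ne.symm hcon)) (hx _ hcon)

/-! ### Counting -/

open Classical in
theorem card_bdry_le {n k : ℕ} (hk : 3 ≤ k) (f : Profile n k → Fin k) (i0 : Fin n)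
    (a b : Fin k) (j : Fin n) :
    (univ.filter (fun σ : Profile n k => BdryAt f i0 a b j σ)).card ≤
      (Nat.factorial k) ^ 2 * (univ.filter (fun σ : Profile n k => IsManipPoint f σ)).card := by
  have hsub : univ.filter (fun σ : Profile n k => BdryAt f i0 a b j σ) ⊆
      ((univ : Finset (Equiv.Perm (Fin k) × Equiv.Perm (Fin k))) ×ˢ
        univ.filter (fun σ : Profile n k => IsManipPoint f σ)).image
        (fun q => Function.update (Function.update q.2 j q.1.1) i0 q.1.2) := by
    intro σ hσ
    simp only [mem_filter, mem_univ, true_and] at hσ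
    obtain ⟨x, y, hM⟩ := exists_manip_of_bdry hk f i0 a b j σ hσ
    simp only [mem_image, mem_product, mem_univ, true_and, mem_filter]
    refine ⟨((σ j, σ i0), Function.update (Function.update σ j y) i0 x), hM, ?_⟩
    funext l
    by_cases h0 : l = i0
    · subst h0; simp
    · by_cases h1 : l = j
      · subst h1; simp [Function.update_of_ne h0]
      · dsimp only
        rw [Function.update_of_ne h0, Function.update_of_ne h1, Function.update_of_ne h0,
          Function.update_of_ne h1]
  refine (card_le_card hsub).trans (card_image_le.trans ?_)
  rw [card_product, card_univ, Fintype.card_prod, Fintype.card_perm, Fintype.card_fin, sq]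

/-- Hybrid of two profiles: coordinates below `j` from the second one. -/
def hyb {n k : ℕ} (j : ℕ) (σ σ' : Profile n k) : Profile n k :=
  fun i => if (i : ℕ) < j then σ' i else σ i

theorem hyb_succ {n k : ℕ} (j : Fin n) (σ σ' : Profile n k) :
    hyb (j + 1) σ σ' = Function.update (hyb j σ σ') j (σ' j) := by
  funext i
  by_cases h : i = j
  · subst h; simp [hyb]
  · have h' : (i : ℕ) ≠ j := fun e => h (Fin.ext e)
    have : (i : ℕ) < j + 1 ↔ (i : ℕ) < j := by omega
    simp [hyb, Function.update_of_ne h, this]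

/-- The involution exchanging the coordinates below `j`. -/
def hybEquiv (n k : ℕ) (j : ℕ) : Profile n k × Profile n k ≃ Profile n k × Profile n k where
  toFun q := (hyb j q.1 q.2, hyb j q.2 q.1)
  invFun q := (hyb j q.1 q.2, hyb j q.2 q.1)
  left_inv q := by
    ext1 <;> funext i <;> by_cases h : (i : ℕ) < j <;> simp [hyb, h]
  right_inv q := by
    ext1 <;> funext i <;> by_cases h : (i : ℕ) < j <;> simp [hyb, h]

theorem exists_step {n k : ℕ} (f : Profile n k → Fin k) (i0 : Fin n) (a b : Fin k)
    (σ σ' : Profile n k) (hD : InD1 f i0 a b σ)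
    (hne : f σ' ≠ f (Function.update σ i0 (σ' i0))) :
    ∃ j : Fin n, BdryAt f i0 a b j (hyb j σ σ') := by
  by_contra hno
  push Not at hno
  have key : ∀ j : ℕ, j ≤ n → ∀ τ, f (Function.update (hyb j σ σ') i0 τ) =
      f (Function.update σ i0 τ) := by
    intro j
    induction j with
    | zero => intro _ τ; congr 2
    | succ j ih =>
      intro hj τ
      have ih := ih (by omega)
      rw [← ih τ]
      by_contra hcon
      refine hno ⟨j, by omega⟩ ⟨?_, τ, σ' ⟨j, by omega⟩, ?_⟩
      · obtain ⟨H, h1, h2, h3, h4⟩ := hD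
        refine ⟨H, h1, h2, h3, fun τ => ?_⟩
        have := h4 τ
        rw [← ih τ] at this
        exact this
      · have := hyb_succ ⟨j, by omega⟩ σ σ'
        simp only at this
        rw [← this]
        exact hcon
  have h := key n le_rfl (σ' i0)
  have h' : hyb n σ σ' = σ' := by funext i; simp [hyb]
  rw [h', Function.update_eq_self] at h
  exact hne h

open Classical in
theorem main_count {n k : ℕ} (hk : 3 ≤ k) (ε : ℝ)
    (f : Profile n k → Fin k) (i0 : Fin n) (a b : Fin k)
    (hD : ∀ g : Profile n k → Fin k, InNonManipBar g →
      ε ≤ prob (fun σ : Profile n k => f σ ≠ g σ)) :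
    ε * prob (fun σ : Profile n k => InD1 f i0 a b σ) ≤
      n * (Nat.factorial k : ℝ) ^ 2 * prob (fun σ : Profile n k => IsManipPoint f σ) := by
  set N : ℝ := (Fintype.card (Profile n k) : ℝ) with hN
  have hNpos : 0 < N := by
    rw [hN]; exact_mod_cast Fintype.card_pos
  set D := univ.filter (fun σ : Profile n k => InD1 f i0 a b σ) with hDdef
  set M := univ.filter (fun σ : Profile n k => IsManipPoint f σ) with hMdef
  have hpD : prob (fun σ : Profile n k => InD1 f i0 a b σ) = D.card / N := by
    simp only [prob, hDdef, hN]
  have hpM : prob (fun σ : Profile n k => IsManipPoint f σ) = M.card / N := by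
    simp only [prob, hMdef, hN]
  let E : Finset (Profile n k × Profile n k) := univ.filter
    (fun q => InD1 f i0 a b q.1 ∧ f q.2 ≠ f (Function.update q.1 i0 (q.2 i0)))
  let Ej : Fin n → Finset (Profile n k × Profile n k) := fun j =>
    univ.filter (fun q => BdryAt f i0 a b j (hyb j q.1 q.2))
  have hlow : ε * N * D.card ≤ E.card := by
    have hE : E.card = ∑ σ ∈ D, (univ.filter
        (fun σ' : Profile n k => f σ' ≠ f (Function.update σ i0 (σ' i0)))).card := by
      rw [← Finset.card_sigma]
      refine Finset.card_bij' (fun q _ => ⟨q.1, q.2⟩) (fun q _ => (q.1, q.2)) ?_ ?_ ?_ ?_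
      · intro q hq; simpa [E, hDdef] using hq
      · intro q hq; simpa [E, hDdef] using hq
      · intro q hq; rfl
      · intro q hq; rfl
    rw [hE]
    push_cast
    have : ε * N * D.card = ∑ σ ∈ D, ε * N := by
      rw [Finset.sum_const, nsmul_eq_mul]; ring
    rw [this]
    refine Finset.sum_le_sum fun σ hσ => ?_
    have h := hD (fun π => f (Function.update σ i0 (π i0)))
      (Or.inl ⟨i0, fun π π' e => by simp only [e]⟩)
    simp only [prob] at h
    rw [le_div_iff₀ hNpos] at h
    exact h.trans (Nat.cast_le.mpr (card_le_card (by intro x hx; simpa using hx)))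
  have hup : E.card ≤ ∑ j, (Ej j).card := by
    refine (card_le_card ?_).trans card_biUnion_le
    intro q hq
    simp only [E, mem_filter, mem_univ, true_and] at hq
    simp only [mem_biUnion, mem_univ, true_and, Ej, mem_filter]
    exact exists_step f i0 a b q.1 q.2 hq.1 hq.2
  have hEj : ∀ j, (Ej j).card ≤ (Nat.factorial k) ^ 2 * M.card * Fintype.card (Profile n k) := by
    intro j
    have : (Ej j).card = (univ.filter (fun σ : Profile n k => BdryAt f i0 a b j σ) ×ˢ
        (univ : Finset (Profile n k))).card := by
      refine Finset.card_equiv (hybEquiv n k j) ?_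
      intro q
      simp [Ej, hybEquiv]
    rw [this, card_product, card_univ]
    exact Nat.mul_le_mul_right _ (card_bdry_le hk f i0 a b j)
  have htot : (E.card : ℝ) ≤ n * ((Nat.factorial k : ℝ) ^ 2 * M.card * N) := by
    have : E.card ≤ n * ((Nat.factorial k) ^ 2 * M.card * Fintype.card (Profile n k)) := by
      refine hup.trans ((Finset.sum_le_sum fun j _ => hEj j).trans ?_)
      simp
    rw [hN]
    exact_mod_cast this
  have hfin : ε * N * D.card ≤ n * ((Nat.factorial k : ℝ) ^ 2 * M.card * N) := hlow.trans htot
  rw [hpD, hpM, ← mul_div_assoc, ← mul_div_assoc, div_le_div_iff_of_pos_right hNpos]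
  refine le_of_mul_le_mul_right ?_ hNpos
  linarith

theorem stmt10 (n k : ℕ) (hn : 2 ≤ n) (hk : 3 ≤ k)
    (ε : ℝ) (hε0 : 0 < ε) (hε1 : ε ≤ 1)
    (f : Profile n k → Fin k) (a b : Fin k) (hab : a ≠ b)
    (hD : ∀ g : Profile n k → Fin k, InNonManipBar g →
      ε ≤ prob (fun σ : Profile n k => f σ ≠ g σ)) :
    prob (fun σ : Profile n k => InD1 f ⟨0, by omega⟩ a b σ) ≤
        ε ^ 4 / (4 * (n : ℝ) ^ 5 * (k : ℝ) ^ 12 * (Nat.factorial k : ℝ)) ∨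
      ε ^ 5 / (4 * (n : ℝ) ^ 7 * (k : ℝ) ^ 12 * (Nat.factorial k : ℝ) ^ 4) ≤
        prob (fun σ : Profile n k => IsManipPoint f σ) := by
  rw [or_iff_not_imp_left]
  intro hnot
  have hlt := not_le.mp hnot
  have hmain := main_count hk ε f ⟨0, by omega⟩ a b hD
  set P := prob (fun σ : Profile n k => InD1 f ⟨0, by omega⟩ a b σ)
  set Q := prob (fun σ : Profile n k => IsManipPoint f σ)
  have hn1 : (1 : ℝ) ≤ n := by exact_mod_cast (by omega : 1 ≤ n)
  have hn0 : (0 : ℝ) < n := by linarith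
  have hk0 : (0 : ℝ) < k := by exact_mod_cast (by omega : 0 < k)
  have hf1 : (1 : ℝ) ≤ (Nat.factorial k : ℝ) := by exact_mod_cast Nat.factorial_pos k
  have hf0 : (0 : ℝ) < (Nat.factorial k : ℝ) := by linarith
  have h1 : ε * (ε ^ 4 / (4 * (n : ℝ) ^ 5 * (k : ℝ) ^ 12 * (Nat.factorial k : ℝ))) ≤
      n * (Nat.factorial k : ℝ) ^ 2 * Q :=
    (mul_le_mul_of_nonneg_left hlt.le hε0.le).trans hmain
  have hpos : (0 : ℝ) < n * (Nat.factorial k : ℝ) ^ 2 := by positivity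
  refine le_of_mul_le_mul_left ?_ hpos
  refine le_trans ?_ h1
  have e : n * (Nat.factorial k : ℝ) ^ 2 *
      (ε ^ 5 / (4 * (n : ℝ) ^ 7 * (k : ℝ) ^ 12 * (Nat.factorial k : ℝ) ^ 4)) =
      ε * (ε ^ 4 / (4 * (n : ℝ) ^ 5 * (k : ℝ) ^ 12 * (Nat.factorial k : ℝ))) *
        (1 / (n * (Nat.factorial k : ℝ))) := by
    field_simp
  rw [e]
  refine mul_le_of_le_one_right (by positivity) ?_
  rw [div_le_one (by positivity)]
  nlinarith
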